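/- Under the setting of the homogenization formula (bounded, 1-periodic interaction densities G^ξ for |ξ| ≤ R on the lattice ℤ^m with values of spins in S^{N-1}, N ≥ 2), the function G_hom(z) = lim_{T→∞} (1/T^m) inf{ E₁(u; Q_T) : ⟨u⟩^{d,1}_{Q_T} = z } is convex on the closed unit ball B₁^N of ℝ^N. -/

import Mathlib

open Classical

/-- Lattice points of `ℤ^m` lying in the open cube `(0,T)^m`. -/
noncomputable def latticeCube (m : ℕ) (T : ℝ) : Finset (Fin m → ℤ) :=
  (Finset.Icc (fun _ => (0 : ℤ)) (fun _ => ⌈T⌉)).filter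
    (fun β => ∀ j, (0 : ℝ) < (β j : ℝ) ∧ (β j : ℝ) < T)

/-- Interaction ranges `ξ ∈ ℤ^m` with Euclidean norm at most `R`. -/
noncomputable def rangeSet (m : ℕ) (R : ℝ) : Finset (Fin m → ℤ) :=
  (Finset.Icc (fun _ => -⌈R⌉) (fun _ => ⌈R⌉)).filter
    (fun ξ => Real.sqrt (∑ j, ((ξ j : ℝ)) ^ 2) ≤ R)

/-- The discrete energy `E₁(u; Q_T)` of a spin field `u`. -/
noncomputable def latticeEnergy (m N : ℕ) (R : ℝ)
    (G : (Fin m → ℤ) → (Fin m → ℤ) → EuclideanSpace ℝ (Fin N) →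
      EuclideanSpace ℝ (Fin N) → ℝ)
    (T : ℝ) (u : (Fin m → ℤ) → EuclideanSpace ℝ (Fin N)) : ℝ :=
  ∑ ξ ∈ rangeSet m R,
    ∑ β ∈ (latticeCube m T).filter (fun β => β + ξ ∈ latticeCube m T),
      G ξ β (u β) (u (β + ξ))

/-- The normalized infimum `g_T(z)` with exact discrete average constraint. -/
noncomputable def gT (m N : ℕ) (R : ℝ)
    (G : (Fin m → ℤ) → (Fin m → ℤ) → EuclideanSpace ℝ (Fin N) →
      EuclideanSpace ℝ (Fin N) → ℝ)
    (T : ℝ) (z : EuclideanSpace ℝ (Fin N)) : ℝ :=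
  (1 / T ^ m) * sInf { e : ℝ |
    ∃ u : (Fin m → ℤ) → EuclideanSpace ℝ (Fin N),
      (∀ β, ‖u β‖ = 1) ∧
      (((latticeCube m T).card : ℝ))⁻¹ • ∑ β ∈ latticeCube m T, u β = z ∧
      e = latticeEnergy m N R G T u }

section UnitVectors

variable {E : Type*} [NormedAddCommGroup E] [InnerProductSpace ℝ E]

theorem exists_unit_add_unit_eq [FiniteDimensional ℝ E] (hE : 2 ≤ Module.finrank ℝ E)
    {y : E} (hy : ‖y‖ ≤ 2) : ∃ v w : E, ‖v‖ = 1 ∧ ‖w‖ = 1 ∧ v + w = y := by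
  obtain ⟨e₀, he₀, hne⟩ : ∃ e ∈ (Submodule.span ℝ {y})ᗮ, e ≠ 0 := by
    by_contra! h
    have hbot : (Submodule.span ℝ {y})ᗮ = ⊥ := (Submodule.eq_bot_iff _).2 h
    rw [Submodule.orthogonal_eq_bot_iff] at hbot
    have h1 := finrank_span_le_card (R := ℝ) ({y} : Set E)
    rw [hbot, finrank_top] at h1
    simp at h1
    omega
  have horth : inner ℝ y e₀ = 0 := Submodule.mem_orthogonal_singleton_iff_inner_right.1 he₀
  have hpos : 0 < ‖e₀‖ := norm_pos_iff.2 hne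
  set s : ℝ := √(1 - ‖y‖ ^ 2 / 4) with hs
  have hs2 : s ^ 2 = 1 - ‖y‖ ^ 2 / 4 :=
    Real.sq_sqrt (by nlinarith [norm_nonneg y])
  have key : ∀ r : ℝ, r ^ 2 = s ^ 2 → ‖(1 / 2 : ℝ) • y + (r / ‖e₀‖) • e₀‖ = 1 := by
    intro r hr
    have h2 : ‖(1 / 2 : ℝ) • y + (r / ‖e₀‖) • e₀‖ ^ 2 = 1 := by
      rw [norm_add_sq_real, inner_smul_left, inner_smul_right, horth, norm_smul, norm_smul,
        mul_pow, mul_pow, Real.norm_eq_abs, Real.norm_eq_abs, sq_abs, sq_abs, div_pow r,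
        div_mul_cancel₀ _ (by positivity), hr, hs2]
      simp
      ring
    exact (pow_eq_one_iff_of_nonneg (norm_nonneg _) two_ne_zero).1 h2
  refine ⟨_, _, key s rfl, key (-s) (by ring), ?_⟩
  rw [neg_div, neg_smul]
  module

theorem exists_unit_norm_sub_le [Nontrivial E] {y : E} {k : ℝ} (hk : 1 ≤ k) (hy : ‖y‖ ≤ k + 1) :
    ∃ v : E, ‖v‖ = 1 ∧ ‖y - v‖ ≤ k := by
  rcases eq_or_ne y 0 with rfl | hne
  · obtain ⟨v, hv⟩ := exists_norm_eq E zero_le_one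
    exact ⟨v, hv, by simpa [hv] using hk⟩
  · have hpos : 0 < ‖y‖ := norm_pos_iff.2 hne
    refine ⟨‖y‖⁻¹ • y, by rw [norm_smul, norm_inv, norm_norm, inv_mul_cancel₀ hpos.ne'], ?_⟩
    have h : y - ‖y‖⁻¹ • y = (1 - ‖y‖⁻¹) • y := by module
    rw [h, norm_smul, Real.norm_eq_abs, ← abs_of_pos hpos, ← abs_mul, abs_of_pos hpos, sub_mul,
      inv_mul_cancel₀ hpos.ne', one_mul, abs_le]
    constructor <;> linarith

theorem exists_unit_sum_eq [FiniteDimensional ℝ E] (hE : 2 ≤ Module.finrank ℝ E)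
    {ι : Type*} (s : Finset ι) (hs : 2 ≤ s.card) {y : E} (hy : ‖y‖ ≤ s.card) :
    ∃ u : ι → E, (∀ i, ‖u i‖ = 1) ∧ ∑ i ∈ s, u i = y := by
  have : Nontrivial E := Module.nontrivial_of_finrank_pos (R := ℝ) (by omega)
  obtain ⟨k, hk⟩ : ∃ k, k = s.card := ⟨_, rfl⟩
  rw [← hk] at hs hy
  induction k, hs using Nat.le_induction generalizing s y with
  | base =>
    obtain ⟨a, b, hab, rfl⟩ := Finset.card_eq_two.1 hk.symm
    obtain ⟨v, w, hv, hw, rfl⟩ := exists_unit_add_unit_eq hE (y := y) (by exact_mod_cast hy)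
    refine ⟨fun i => if i = a then v else w, fun i => by beta_reduce; split_ifs <;> assumption, ?_⟩
    rw [Finset.sum_pair hab, if_pos rfl, if_neg hab.symm]
  | succ k h2 ih =>
    obtain ⟨a, s', ha, rfl, hk'⟩ := Finset.card_eq_succ.1 hk.symm
    obtain ⟨v, hv, hyv⟩ := exists_unit_norm_sub_le (y := y) (k := k)
      (by exact_mod_cast (by omega : 1 ≤ k)) (by exact_mod_cast hy)
    obtain ⟨u, hu, hsum⟩ := ih s' hyv hk'.symm
    refine ⟨Function.update u a v, fun i => ?_, ?_⟩
    · rcases eq_or_ne i a with rfl | hi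
      · simpa using hv
      · simpa [hi] using hu i
    · rw [Finset.sum_insert ha, Finset.sum_update_of_notMem ha, hsum, Function.update_self]
      abel

end UnitVectors

section RationalConvexity

variable {E : Type*} [AddCommGroup E] [Module ℝ E]

/-- On a convex set, a function that is bounded above and satisfies the convexity inequality for
rational weights is convex. -/
theorem convexOn_of_rat_of_bddAbove {s : Set E} (hs : Convex ℝ s) {f : E → ℝ} {M : ℝ}
    (hM : ∀ x ∈ s, f x ≤ M)
    (hf : ∀ x ∈ s, ∀ y ∈ s, ∀ q : ℚ, 0 ≤ q → q ≤ 1 →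
      f ((q : ℝ) • x + (1 - (q : ℝ)) • y) ≤ q * f x + (1 - q) * f y) :
    ConvexOn ℝ s f := by
  have small : ∀ x ∈ s, ∀ y ∈ s, ∀ q : ℚ, 0 < q → q ≤ 1 → ∀ r : ℝ, 0 ≤ r → r ≤ q →
      f (r • x + (1 - r) • y) ≤ q * M + (1 - q) * f y := by
    intro x hx y hy q hq0 hq1 r hr0 hrq
    have hq0' : (0 : ℝ) < q := by exact_mod_cast hq0
    have hw : (r / q) • x + (1 - r / q) • y ∈ s :=
      hs hx hy (by positivity) (by rw [sub_nonneg, div_le_one hq0']; exact hrq) (by ring)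
    have h := hf _ hw y hy q hq0.le hq1
    have e : (q : ℝ) • ((r / q) • x + (1 - r / q) • y) + (1 - (q : ℝ)) • y
        = r • x + (1 - r) • y := by
      match_scalars
      · field_simp
      · field_simp
        ring
    rw [e] at h
    exact h.trans (by gcongr; exact hM _ hw)
  refine ⟨hs, fun x hx y hy a b ha hb hab => ?_⟩
  obtain rfl : b = 1 - a := by linarith
  rcases eq_or_lt_of_le hb with hb0 | hb0
  · obtain rfl : a = 1 := by linarith
    simp
  rw [smul_eq_mul, smul_eq_mul]
  -- Approximate `a` from below by rationals `q`, and write the point as a rational combination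
  -- of `x` and of a point close to `y`.
  have bound : ∀ p : ℚ, 0 < p → p ≤ 1 → ∀ q : ℚ, 0 ≤ q → (q : ℝ) ≤ a → a - q ≤ p * (1 - a) →
      f (a • x + (1 - a) • y) ≤ q * f x + (1 - q) * (p * M + (1 - p) * f y) := by
    intro p hp0 hp1 q hq0 hqa hqp
    have hq1 : (0 : ℝ) < 1 - q := by linarith
    have hp0' : (0 : ℝ) < p := by exact_mod_cast hp0
    set r : ℝ := (a - q) / (1 - q) with hr
    have hr0 : 0 ≤ r := div_nonneg (by linarith) hq1.le
    have hrp : r ≤ p := by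
      rw [hr, div_le_iff₀ hq1]
      nlinarith
    have hp1' : (p : ℝ) ≤ 1 := by exact_mod_cast hp1
    have hw : r • x + (1 - r) • y ∈ s := hs hx hy hr0 (by linarith) (by ring)
    have h := hf x hx _ hw q hq0 (by exact_mod_cast (by linarith : (q : ℝ) ≤ 1))
    have e : (q : ℝ) • x + (1 - (q : ℝ)) • (r • x + (1 - r) • y) = a • x + (1 - a) • y := by
      have hrm : (1 - (q : ℝ)) * r = a - q := by rw [hr]; field_simp
      match_scalars
      · linarith
      · linarith
    rw [e] at h
    exact h.trans (by gcongr; exact small x hx y hy p hp0 hp1 r hr0 hrp)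
  rcases eq_or_lt_of_le ha with ha0 | ha0
  · subst ha0
    simp
  -- Let `q → a` along rationals from below, then `p → 0`.
  have step : ∀ p : ℚ, 0 < p → p ≤ 1 →
      f (a • x + (1 - a) • y) ≤ a * f x + (1 - a) * (p * M + (1 - p) * f y) := by
    intro p hp0 hp1
    have hp0' : (0 : ℝ) < p := by exact_mod_cast hp0
    set φ : ℝ → ℝ := fun q => q * f x + (1 - q) * (p * M + (1 - p) * f y) with hφ
    have hcont : Continuous φ := by fun_prop
    refine le_of_forall_pos_lt_add fun ε hε => ?_
    obtain ⟨δ, hδ, hδ'⟩ := Metric.continuousAt_iff.1 (hcont.continuousAt (x := a)) ε hε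
    obtain ⟨q, hq, hqa⟩ := exists_rat_btwn (show max 0 (max (a - δ) (a - p * (1 - a))) < a from
      max_lt ha0 (max_lt (by linarith) (by nlinarith)))
    simp only [max_lt_iff] at hq
    have h1 := bound p hp0 hp1 q (by exact_mod_cast hq.1.le) hqa.le (by linarith [hq.2.2])
    have h2 := hδ' (x := (q : ℝ)) (by rw [Real.dist_eq, abs_lt]; constructor <;> linarith [hq.2.1])
    rw [Real.dist_eq, abs_lt] at h2
    have h3 : f (a • x + (1 - a) • y) ≤ φ q := h1
    change _ < φ a + ε
    linarith [h2.2]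
  set ψ : ℝ → ℝ := fun p => a * f x + (1 - a) * (p * M + (1 - p) * f y) with hψ
  have hcont : Continuous ψ := by fun_prop
  have hψ0 : ψ 0 = a * f x + (1 - a) * f y := by simp [hψ]
  rw [← hψ0]
  refine le_of_forall_pos_lt_add fun ε hε => ?_
  obtain ⟨δ, hδ, hδ'⟩ := Metric.continuousAt_iff.1 (hcont.continuousAt (x := 0)) ε hε
  obtain ⟨p, hp, hpδ⟩ := exists_rat_btwn (lt_min hδ one_pos)
  rw [lt_min_iff] at hpδ
  have h1 : f (a • x + (1 - a) • y) ≤ ψ p :=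
    step p (by exact_mod_cast hp) (by exact_mod_cast hpδ.2.le)
  have h2 := hδ' (x := (p : ℝ)) (by rw [Real.dist_eq, abs_lt]; constructor <;> linarith [hpδ.1])
  rw [Real.dist_eq, abs_lt] at h2
  linarith [h2.2]

end RationalConvexity

section Lattice

variable {m : ℕ}

theorem mem_latticeCube_natCast_add_one {n : ℕ} {β : Fin m → ℤ} :
    β ∈ latticeCube m ((n : ℝ) + 1) ↔ ∀ j, 1 ≤ β j ∧ β j ≤ n := by
  have hc : ⌈(n : ℝ) + 1⌉ = (n : ℤ) + 1 := by exact_mod_cast Int.ceil_intCast (R := ℝ) ((n : ℤ) + 1)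
  have hlt : ∀ k : ℤ, ((0 : ℝ) < k ∧ (k : ℝ) < n + 1) ↔ 1 ≤ k ∧ k ≤ n := fun k => by
    have h1 : (0 : ℝ) < k ↔ 0 < k := by exact_mod_cast Iff.rfl
    have h2 : (k : ℝ) < n + 1 ↔ k < n + 1 := by exact_mod_cast Iff.rfl
    rw [h1, h2]
    omega
  simp only [latticeCube, Finset.mem_filter, Finset.mem_Icc, hlt, hc]
  refine ⟨fun h => h.2, fun h => ⟨⟨fun j => ?_, fun j => ?_⟩, h⟩⟩ <;>
  · have := h j
    dsimp only
    omega

theorem latticeCube_natCast_add_one (n : ℕ) :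
    latticeCube m ((n : ℝ) + 1) = Fintype.piFinset fun _ => Finset.Icc (1 : ℤ) n := by
  ext β
  simp [mem_latticeCube_natCast_add_one, Fintype.mem_piFinset]

theorem card_latticeCube_natCast_add_one (n : ℕ) :
    (latticeCube m ((n : ℝ) + 1)).card = n ^ m := by
  simp [latticeCube_natCast_add_one, Fintype.card_piFinset]

theorem abs_le_of_mem_rangeSet {R : ℝ} {ξ : Fin m → ℤ} (hξ : ξ ∈ rangeSet m R) (j : Fin m) :
    |ξ j| ≤ ⌈R⌉₊ := by
  simp only [rangeSet, Finset.mem_filter, Finset.mem_Icc] at hξ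
  have h1 := hξ.1.1 j
  have h2 := hξ.1.2 j
  dsimp only at h1 h2
  rw [abs_le]
  have := Int.self_le_toNat ⌈R⌉
  rw [Int.ceil_toNat] at this
  omega

/-- Few points of a large cube leave it under a bounded translation. -/
theorem card_filter_add_notMem_latticeCube_le {n L : ℕ} (hL : 2 * L ≤ n) {ξ : Fin m → ℤ}
    (hξ : ∀ j, |ξ j| ≤ L) :
    (((latticeCube m ((n : ℝ) + 1)).filter
      (fun γ => γ + ξ ∉ latticeCube m ((n : ℝ) + 1))).card : ℝ)
      ≤ (n : ℝ) ^ m - ((n : ℝ) - 2 * L) ^ m := by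
  have hadd := Finset.card_filter_add_card_filter_not (s := latticeCube m ((n : ℝ) + 1))
    (fun γ => γ + ξ ∈ latticeCube m ((n : ℝ) + 1))
  rw [card_latticeCube_natCast_add_one] at hadd
  have hsub : (Fintype.piFinset fun _ : Fin m => Finset.Icc ((L : ℤ) + 1) (n - L)) ⊆
      (latticeCube m ((n : ℝ) + 1)).filter (fun γ => γ + ξ ∈ latticeCube m ((n : ℝ) + 1)) := by
    intro γ hγ
    simp only [Fintype.mem_piFinset, Finset.mem_Icc] at hγ
    simp only [Finset.mem_filter, mem_latticeCube_natCast_add_one, Pi.add_apply]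
    refine ⟨fun j => ?_, fun j => ?_⟩ <;>
    · have h1 := hγ j
      have h2 := abs_le.1 (hξ j)
      omega
  have hcard := Finset.card_le_card hsub
  have hInt : ((n : ℤ) - L + 1 - (L + 1)).toNat = n - 2 * L := by omega
  rw [Fintype.card_piFinset] at hcard
  simp only [Int.card_Icc, hInt, Finset.prod_const, Finset.card_univ, Fintype.card_fin] at hcard
  have hcard' : ((n : ℝ) - 2 * L) ^ m ≤ (((latticeCube m ((n : ℝ) + 1)).filter
      (fun γ => γ + ξ ∈ latticeCube m ((n : ℝ) + 1))).card : ℝ) := by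
    have h : (((n - 2 * L) ^ m : ℕ) : ℝ) = ((n : ℝ) - 2 * L) ^ m := by
      push_cast [Nat.cast_sub hL]
      rfl
    rw [← h]
    exact Nat.cast_le.2 hcard
  have hadd' := congrArg (Nat.cast : ℕ → ℝ) hadd
  push_cast at hadd'
  linarith

/-- Indices of the `b ^ m` subcubes tiling a large cube. -/
noncomputable def blockIndices (m b : ℕ) : Finset (Fin m → ℤ) :=
  Fintype.piFinset fun _ => Finset.Ico (0 : ℤ) b

theorem mem_blockIndices {b : ℕ} {c : Fin m → ℤ} :
    c ∈ blockIndices m b ↔ ∀ j, 0 ≤ c j ∧ c j < b := by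
  simp [blockIndices, Fintype.mem_piFinset]

theorem card_blockIndices (b : ℕ) : (blockIndices m b).card = b ^ m := by
  simp [blockIndices, Fintype.card_piFinset]

/-- The index of the subcube of side `n` containing `β`. -/
def blockIndex (n : ℕ) (β : Fin m → ℤ) : Fin m → ℤ := fun j => (β j - 1) / n

/-- The position of `β` inside its subcube of side `n`. -/
def blockPos (n : ℕ) (β : Fin m → ℤ) : Fin m → ℤ := fun j => (β j - 1) % n + 1

theorem blockIndex_smul_add {n : ℕ} (c : Fin m → ℤ) {γ : Fin m → ℤ}
    (hγ : γ ∈ latticeCube m ((n : ℝ) + 1)) : blockIndex n ((n : ℤ) • c + γ) = c := by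
  rw [mem_latticeCube_natCast_add_one] at hγ
  ext j
  have := hγ j
  simp only [blockIndex, Pi.add_apply, Pi.smul_apply, smul_eq_mul, add_sub_assoc]
  rw [add_comm, Int.add_mul_ediv_left _ _ (by omega), Int.ediv_eq_zero_of_lt (by omega) (by omega),
    zero_add]

theorem blockPos_smul_add {n : ℕ} (c : Fin m → ℤ) {γ : Fin m → ℤ}
    (hγ : γ ∈ latticeCube m ((n : ℝ) + 1)) : blockPos n ((n : ℤ) • c + γ) = γ := by
  rw [mem_latticeCube_natCast_add_one] at hγ
  ext j
  have := hγ j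
  simp only [blockPos, Pi.add_apply, Pi.smul_apply, smul_eq_mul, add_sub_assoc]
  rw [add_comm (_ * _), Int.add_mul_emod_self_left, Int.emod_eq_of_lt (by omega) (by omega),
    sub_add_cancel]

theorem smul_blockIndex_add_blockPos (n : ℕ) (β : Fin m → ℤ) :
    (n : ℤ) • blockIndex n β + blockPos n β = β := by
  ext j
  have := Int.mul_ediv_add_emod (β j - 1) n
  simp only [blockIndex, blockPos, Pi.add_apply, Pi.smul_apply, smul_eq_mul]
  linarith

theorem smul_add_mem_latticeCube {b n : ℕ} {c γ : Fin m → ℤ} (hc : c ∈ blockIndices m b)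
    (hγ : γ ∈ latticeCube m ((n : ℝ) + 1)) :
    (n : ℤ) • c + γ ∈ latticeCube m (((b * n : ℕ) : ℝ) + 1) := by
  rw [mem_blockIndices] at hc
  rw [mem_latticeCube_natCast_add_one] at hγ ⊢
  intro j
  have h1 := hc j
  have h2 := hγ j
  simp only [Pi.add_apply, Pi.smul_apply, smul_eq_mul]
  push_cast
  constructor <;> nlinarith

theorem sum_latticeCube_mul {M : Type*} [AddCommMonoid M] {b n : ℕ} (hn : 0 < n)
    (f : (Fin m → ℤ) → M) :
    ∑ β ∈ latticeCube m (((b * n : ℕ) : ℝ) + 1), f β =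
      ∑ c ∈ blockIndices m b, ∑ γ ∈ latticeCube m ((n : ℝ) + 1), f ((n : ℤ) • c + γ) := by
  have hn' : (0 : ℤ) < n := by exact_mod_cast hn
  rw [← Finset.sum_product']
  refine Finset.sum_bij' (fun β _ => (blockIndex n β, blockPos n β))
    (fun p _ => (n : ℤ) • p.1 + p.2) (fun β hβ => ?_) (fun p hp => ?_)
    (fun β _ => smul_blockIndex_add_blockPos n β) (fun p hp => ?_)
    (fun β _ => by simp only [smul_blockIndex_add_blockPos])
  · rw [mem_latticeCube_natCast_add_one] at hβ
    rw [Finset.mem_product, mem_blockIndices, mem_latticeCube_natCast_add_one]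
    refine ⟨fun j => ⟨Int.ediv_nonneg (by linarith [(hβ j).1]) hn'.le, ?_⟩, fun j => ?_⟩
    · have := (hβ j).2
      push_cast at this
      exact Int.ediv_lt_of_lt_mul hn' (by linarith)
    · have h1 := Int.emod_nonneg (β j - 1) hn'.ne'
      have h2 := Int.emod_lt_of_pos (β j - 1) hn'
      simp only [blockPos]
      omega
  · rw [Finset.mem_product] at hp
    exact smul_add_mem_latticeCube hp.1 hp.2
  · rw [Finset.mem_product] at hp
    rw [Prod.ext_iff]
    exact ⟨blockIndex_smul_add _ hp.2, blockPos_smul_add _ hp.2⟩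

end Lattice

section Energy

variable {m N : ℕ} {R : ℝ} {G : (Fin m → ℤ) → (Fin m → ℤ) → EuclideanSpace ℝ (Fin N) →
      EuclideanSpace ℝ (Fin N) → ℝ}

/-- Energies of the spin fields with average `z` on the cube of side `T`. -/
def admissibleEnergies (m N : ℕ) (R : ℝ)
    (G : (Fin m → ℤ) → (Fin m → ℤ) → EuclideanSpace ℝ (Fin N) →
      EuclideanSpace ℝ (Fin N) → ℝ)
    (T : ℝ) (z : EuclideanSpace ℝ (Fin N)) : Set ℝ :=
  { e : ℝ |
    ∃ u : (Fin m → ℤ) → EuclideanSpace ℝ (Fin N),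
      (∀ β, ‖u β‖ = 1) ∧
      (((latticeCube m T).card : ℝ))⁻¹ • ∑ β ∈ latticeCube m T, u β = z ∧
      e = latticeEnergy m N R G T u }

theorem abs_latticeEnergy_le {C : ℝ} (hC : ∀ ξ β u v, |G ξ β u v| ≤ C) (n : ℕ)
    (u : (Fin m → ℤ) → EuclideanSpace ℝ (Fin N)) :
    |latticeEnergy m N R G ((n : ℝ) + 1) u| ≤ (rangeSet m R).card * C * n ^ m := by
  have hC0 : 0 ≤ C := (abs_nonneg _).trans (hC 0 0 0 0)
  refine (Finset.abs_sum_le_sum_abs _ _).trans ?_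
  have h : ∀ ξ ∈ rangeSet m R, |∑ β ∈ (latticeCube m ((n : ℝ) + 1)).filter
      (fun β => β + ξ ∈ latticeCube m ((n : ℝ) + 1)), G ξ β (u β) (u (β + ξ))| ≤ C * n ^ m := by
    intro ξ _
    refine (Finset.abs_sum_le_sum_abs _ _).trans ((Finset.sum_le_card_nsmul _ _ C
      fun β _ => hC _ _ _ _).trans ?_)
    rw [nsmul_eq_mul, mul_comm]
    gcongr
    rw [← Nat.cast_pow, ← card_latticeCube_natCast_add_one]
    exact_mod_cast Finset.card_filter_le _ _
  refine (Finset.sum_le_card_nsmul _ _ _ h).trans_eq ?_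
  rw [nsmul_eq_mul, mul_assoc]

theorem abs_sInf_admissibleEnergies_le {C : ℝ} (hC : ∀ ξ β u v, |G ξ β u v| ≤ C) (n : ℕ)
    (z : EuclideanSpace ℝ (Fin N)) :
    |sInf (admissibleEnergies m N R G ((n : ℝ) + 1) z)| ≤ (rangeSet m R).card * C * n ^ m := by
  have hC0 : 0 ≤ C := (abs_nonneg _).trans (hC 0 0 0 0)
  rcases (admissibleEnergies m N R G ((n : ℝ) + 1) z).eq_empty_or_nonempty with h | h
  · rw [h, Real.sInf_empty, abs_zero]
    positivity
  · have hb : ∀ e ∈ admissibleEnergies m N R G ((n : ℝ) + 1) z,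
        |e| ≤ (rangeSet m R).card * C * n ^ m := by
      rintro e ⟨u, -, -, rfl⟩
      exact abs_latticeEnergy_le hC n u
    obtain ⟨e, he⟩ := h
    exact abs_le.2 ⟨le_csInf ⟨e, he⟩ fun e' he' => (abs_le.1 (hb e' he')).1,
      (csInf_le ⟨_, fun e' he' => (abs_le.1 (hb e' he')).1⟩ he).trans (abs_le.1 (hb e he)).2⟩

theorem bddBelow_admissibleEnergies {C : ℝ} (hC : ∀ ξ β u v, |G ξ β u v| ≤ C) (n : ℕ)
    (z : EuclideanSpace ℝ (Fin N)) : BddBelow (admissibleEnergies m N R G ((n : ℝ) + 1) z) := by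
  refine ⟨-((rangeSet m R).card * C * n ^ m), ?_⟩
  rintro e ⟨u, -, -, rfl⟩
  exact (abs_le.1 (abs_latticeEnergy_le hC n u)).1

theorem admissibleEnergies_nonempty (hm : 1 ≤ m) (hN : 2 ≤ N) {n : ℕ} (hn : 2 ≤ n)
    {z : EuclideanSpace ℝ (Fin N)} (hz : ‖z‖ ≤ 1) :
    (admissibleEnergies m N R G ((n : ℝ) + 1) z).Nonempty := by
  have hcard : 2 ≤ (latticeCube m ((n : ℝ) + 1)).card := by
    rw [card_latticeCube_natCast_add_one]
    exact hn.trans (Nat.le_self_pow (by omega) n)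
  have hpos : (0 : ℝ) < (latticeCube m ((n : ℝ) + 1)).card := by
    exact_mod_cast (by omega : 0 < (latticeCube m ((n : ℝ) + 1)).card)
  obtain ⟨u, hu, hsum⟩ := exists_unit_sum_eq (by simpa using hN) (latticeCube m ((n : ℝ) + 1))
    hcard (y := ((latticeCube m ((n : ℝ) + 1)).card : ℝ) • z)
    (by rw [norm_smul, Real.norm_of_nonneg hpos.le]; exact mul_le_of_le_one_right hpos.le hz)
  exact ⟨_, u, hu, by rw [hsum, inv_smul_smul₀ hpos.ne'], rfl⟩

/-- The energy of a field on a large cube exceeds the sum of the energies of its restrictions to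
the subcubes of a tiling by at most a boundary term. -/
theorem latticeEnergy_mul_le {C : ℝ} (hC : ∀ ξ β u v, |G ξ β u v| ≤ C)
    (hGper : ∀ ξ β γ u v, G ξ (β + γ) u v = G ξ β u v) {b n : ℕ} (hn : 0 < n)
    (hnR : 2 * ⌈R⌉₊ ≤ n) (U : (Fin m → ℤ) → EuclideanSpace ℝ (Fin N))
    (w : (Fin m → ℤ) → (Fin m → ℤ) → EuclideanSpace ℝ (Fin N))
    (hU : ∀ c, ∀ γ ∈ latticeCube m ((n : ℝ) + 1), U ((n : ℤ) • c + γ) = w c γ) :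
    latticeEnergy m N R G (((b * n : ℕ) : ℝ) + 1) U ≤
      ∑ c ∈ blockIndices m b, latticeEnergy m N R G ((n : ℝ) + 1) (w c) +
      (rangeSet m R).card * C * b ^ m * ((n : ℝ) ^ m - ((n : ℝ) - 2 * ⌈R⌉₊) ^ m) := by
  have hC0 : 0 ≤ C := (abs_nonneg _).trans (hC 0 0 0 0)
  simp only [latticeEnergy]
  rw [Finset.sum_comm]
  have hξ : ∀ ξ ∈ rangeSet m R,
      ∑ β ∈ (latticeCube m (((b * n : ℕ) : ℝ) + 1)).filter
        (fun β => β + ξ ∈ latticeCube m (((b * n : ℕ) : ℝ) + 1)), G ξ β (U β) (U (β + ξ)) ≤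
      ∑ c ∈ blockIndices m b, ∑ γ ∈ (latticeCube m ((n : ℝ) + 1)).filter
        (fun γ => γ + ξ ∈ latticeCube m ((n : ℝ) + 1)), G ξ γ (w c γ) (w c (γ + ξ)) +
      C * b ^ m * ((n : ℝ) ^ m - ((n : ℝ) - 2 * ⌈R⌉₊) ^ m) := by
    intro ξ hξ
    rw [Finset.sum_filter, sum_latticeCube_mul hn]
    have hblock : ∀ c ∈ blockIndices m b, ∑ γ ∈ latticeCube m ((n : ℝ) + 1),
        (if (n : ℤ) • c + γ + ξ ∈ latticeCube m (((b * n : ℕ) : ℝ) + 1) then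
          G ξ ((n : ℤ) • c + γ) (U ((n : ℤ) • c + γ)) (U ((n : ℤ) • c + γ + ξ)) else 0) ≤
        ∑ γ ∈ (latticeCube m ((n : ℝ) + 1)).filter
          (fun γ => γ + ξ ∈ latticeCube m ((n : ℝ) + 1)), G ξ γ (w c γ) (w c (γ + ξ)) +
        C * ((n : ℝ) ^ m - ((n : ℝ) - 2 * ⌈R⌉₊) ^ m) := by
      intro c hc
      have hbad : ∑ γ ∈ latticeCube m ((n : ℝ) + 1),
          (if γ + ξ ∉ latticeCube m ((n : ℝ) + 1) then C else 0) ≤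
          C * ((n : ℝ) ^ m - ((n : ℝ) - 2 * ⌈R⌉₊) ^ m) := by
        rw [← Finset.sum_filter, Finset.sum_const, nsmul_eq_mul, mul_comm]
        gcongr
        exact card_filter_add_notMem_latticeCube_le hnR (abs_le_of_mem_rangeSet hξ)
      refine le_trans ?_ (add_le_add_right hbad _)
      rw [Finset.sum_filter, ← Finset.sum_add_distrib]
      refine Finset.sum_le_sum fun γ hγ => ?_
      by_cases hmem : γ + ξ ∈ latticeCube m ((n : ℝ) + 1)
      · have h1 : (n : ℤ) • c + γ + ξ ∈ latticeCube m (((b * n : ℕ) : ℝ) + 1) := by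
          rw [add_assoc]
          exact smul_add_mem_latticeCube hc hmem
        rw [if_pos h1, if_pos hmem, if_neg (not_not.2 hmem), hU c γ hγ, add_assoc, hU c _ hmem,
          add_comm ((n : ℤ) • c) γ, hGper, add_zero]
      · rw [if_neg hmem, if_pos hmem, zero_add]
        split_ifs
        · exact (le_abs_self _).trans (hC _ _ _ _)
        · exact hC0
    refine (Finset.sum_le_sum hblock).trans_eq ?_
    rw [Finset.sum_add_distrib, Finset.sum_const, card_blockIndices, nsmul_eq_mul]
    push_cast
    ring
  refine (Finset.sum_le_sum hξ).trans_eq ?_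
  rw [Finset.sum_add_distrib, Finset.sum_const, nsmul_eq_mul]
  ring

/-- Tiling a large cube by `h` copies of a field with average `z₁` and `b ^ m - h` copies of a
field with average `z₂`. -/
theorem exists_mem_admissibleEnergies_mul {C : ℝ} (hC : ∀ ξ β u v, |G ξ β u v| ≤ C)
    (hGper : ∀ ξ β γ u v, G ξ (β + γ) u v = G ξ β u v) {b n h : ℕ} (hb : 0 < b) (hn : 0 < n)
    (hnR : 2 * ⌈R⌉₊ ≤ n) (hh : h ≤ b ^ m) {t : ℝ} (ht : t * (b : ℝ) ^ m = h)
    {z₁ z₂ : EuclideanSpace ℝ (Fin N)} {e₁ e₂ : ℝ}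
    (h₁ : e₁ ∈ admissibleEnergies m N R G ((n : ℝ) + 1) z₁)
    (h₂ : e₂ ∈ admissibleEnergies m N R G ((n : ℝ) + 1) z₂) :
    ∃ e ∈ admissibleEnergies m N R G (((b * n : ℕ) : ℝ) + 1) (t • z₁ + (1 - t) • z₂),
      e ≤ (b : ℝ) ^ m * (t * e₁ + (1 - t) * e₂) +
        (rangeSet m R).card * C * b ^ m * ((n : ℝ) ^ m - ((n : ℝ) - 2 * ⌈R⌉₊) ^ m) := by
  obtain ⟨u₁, hu₁, rfl, rfl⟩ := h₁
  obtain ⟨u₂, hu₂, rfl, rfl⟩ := h₂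
  obtain ⟨S, hS, hScard⟩ := Finset.exists_subset_card_eq
    (s := blockIndices m b) (n := h) (by rwa [card_blockIndices])
  set w : (Fin m → ℤ) → (Fin m → ℤ) → EuclideanSpace ℝ (Fin N) :=
    fun c => if c ∈ S then u₁ else u₂ with hw
  have hsum : ∀ {M : Type} [AddCommGroup M] [Module ℝ M]
      (F : ((Fin m → ℤ) → EuclideanSpace ℝ (Fin N)) → M),
      ∑ c ∈ blockIndices m b, F (w c) = (b : ℝ) ^ m • (t • F u₁ + (1 - t) • F u₂) := by
    intro M _ _ F
    have hF : ∀ c, F (w c) = if c ∈ S then F u₁ else F u₂ := fun c => by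
      simp only [hw]
      split_ifs <;> rfl
    have hcompl : ((blockIndices m b \ S).card : ℝ) = (b : ℝ) ^ m - h := by
      rw [Finset.card_sdiff_of_subset hS, hScard, card_blockIndices, Nat.cast_sub hh, Nat.cast_pow]
    simp only [hF]
    rw [← Finset.sum_sdiff hS, Finset.sum_congr rfl fun c hc => if_neg (Finset.mem_sdiff.1 hc).2,
      Finset.sum_congr rfl fun c (hc : c ∈ S) => if_pos hc, Finset.sum_const, Finset.sum_const,
      ← Nat.cast_smul_eq_nsmul ℝ, ← Nat.cast_smul_eq_nsmul ℝ, hcompl, hScard, ← ht]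
    module
  have hU : ∀ c, ∀ γ ∈ latticeCube m ((n : ℝ) + 1),
      (fun β => w (blockIndex n β) (blockPos n β)) ((n : ℤ) • c + γ) = w c γ := fun c γ hγ => by
    simp only [blockIndex_smul_add c hγ, blockPos_smul_add c hγ]
  refine ⟨_, ⟨fun β => w (blockIndex n β) (blockPos n β), fun β => ?_, ?_, rfl⟩, ?_⟩
  · simp only [hw]
    split_ifs
    exacts [hu₁ _, hu₂ _]
  · have hb' : (b : ℝ) ≠ 0 := by exact_mod_cast hb.ne'
    have hn' : (n : ℝ) ≠ 0 := by exact_mod_cast hn.ne'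
    rw [sum_latticeCube_mul hn, Finset.sum_congr rfl fun c _ => Finset.sum_congr rfl (hU c),
      hsum (fun v => ∑ γ ∈ latticeCube m ((n : ℝ) + 1), v γ), card_latticeCube_natCast_add_one,
      card_latticeCube_natCast_add_one]
    match_scalars <;>
    · rw [mul_pow]
      field_simp
  · refine (latticeEnergy_mul_le hC hGper hn hnR _ w hU).trans_eq ?_
    rw [hsum (latticeEnergy m N R G ((n : ℝ) + 1))]
    simp only [smul_eq_mul]

theorem sInf_admissibleEnergies_mul_le (hm : 1 ≤ m) (hN : 2 ≤ N)
    {C : ℝ} (hC : ∀ ξ β u v, |G ξ β u v| ≤ C)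
    (hGper : ∀ ξ β γ u v, G ξ (β + γ) u v = G ξ β u v) {b n h : ℕ} (hb : 0 < b) (hn : 2 ≤ n)
    (hnR : 2 * ⌈R⌉₊ ≤ n) (hh : h ≤ b ^ m) {t : ℝ} (ht : t * (b : ℝ) ^ m = h)
    (ht0 : 0 ≤ t) (ht1 : t ≤ 1)
    {z₁ z₂ : EuclideanSpace ℝ (Fin N)} (hz₁ : ‖z₁‖ ≤ 1) (hz₂ : ‖z₂‖ ≤ 1) :
    sInf (admissibleEnergies m N R G (((b * n : ℕ) : ℝ) + 1) (t • z₁ + (1 - t) • z₂)) ≤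
      (b : ℝ) ^ m * (t * sInf (admissibleEnergies m N R G ((n : ℝ) + 1) z₁) +
        (1 - t) * sInf (admissibleEnergies m N R G ((n : ℝ) + 1) z₂)) +
      (rangeSet m R).card * C * b ^ m * ((n : ℝ) ^ m - ((n : ℝ) - 2 * ⌈R⌉₊) ^ m) := by
  have hbm : (0 : ℝ) < (b : ℝ) ^ m := by positivity
  refine le_of_forall_pos_le_add fun ε hε => ?_
  have hε' : 0 < ε / (b : ℝ) ^ m := by positivity
  obtain ⟨e₁, h₁, hlt₁⟩ := exists_lt_of_csInf_lt (admissibleEnergies_nonempty (G := G) (R := R)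
    hm hN hn hz₁) (lt_add_of_pos_right _ hε')
  obtain ⟨e₂, h₂, hlt₂⟩ := exists_lt_of_csInf_lt (admissibleEnergies_nonempty (G := G) (R := R)
    hm hN hn hz₂) (lt_add_of_pos_right _ hε')
  obtain ⟨e, he, hle⟩ := exists_mem_admissibleEnergies_mul hC hGper hb (by omega) hnR hh ht h₁ h₂
  refine (csInf_le (bddBelow_admissibleEnergies hC _ _) he).trans (hle.trans ?_)
  have h1t : 0 ≤ 1 - t := by linarith
  have key : (b : ℝ) ^ m * (t * e₁ + (1 - t) * e₂) ≤ (b : ℝ) ^ m *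
      (t * (sInf (admissibleEnergies m N R G ((n : ℝ) + 1) z₁) + ε / (b : ℝ) ^ m) +
        (1 - t) * (sInf (admissibleEnergies m N R G ((n : ℝ) + 1) z₂) + ε / (b : ℝ) ^ m)) := by
    gcongr
  have hcancel : (b : ℝ) ^ m * (ε / (b : ℝ) ^ m) = ε := mul_div_cancel₀ _ hbm.ne'
  linear_combination key + hcancel

theorem tendsto_sInf_admissibleEnergies_div {z : EuclideanSpace ℝ (Fin N)} {l : ℝ}
    (h : Filter.Tendsto (fun T => gT m N R G T z) Filter.atTop (nhds l)) :
    Filter.Tendsto (fun n : ℕ => sInf (admissibleEnergies m N R G ((n : ℝ) + 1) z) / (n : ℝ) ^ m)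
      Filter.atTop (nhds l) := by
  have h1 := h.comp (Filter.tendsto_atTop_add_const_right Filter.atTop (1 : ℝ)
    tendsto_natCast_atTop_atTop)
  have h2 : Filter.Tendsto (fun n : ℕ => (1 + 1 / (n : ℝ)) ^ m) Filter.atTop (nhds 1) := by
    simpa using (tendsto_one_div_atTop_nhds_zero_nat (𝕜 := ℝ)).const_add 1 |>.pow m
  have h3 := h1.mul h2
  rw [mul_one] at h3
  refine h3.congr' ?_
  filter_upwards [Filter.eventually_gt_atTop 0] with n hn
  have hn' : (0 : ℝ) < n := by exact_mod_cast hn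
  have e : 1 + 1 / (n : ℝ) = (n + 1) / n := by field_simp
  simp only [Function.comp_apply, gT, admissibleEnergies]
  rw [e, div_pow]
  have : ((n : ℝ) + 1) ^ m ≠ 0 := by positivity
  field_simp

end Energy

theorem homogenized_density_convex
    (m N : ℕ) (hm : 1 ≤ m) (hN : 2 ≤ N) (R : ℝ) (hR : 0 < R)
    (G : (Fin m → ℤ) → (Fin m → ℤ) → EuclideanSpace ℝ (Fin N) →
      EuclideanSpace ℝ (Fin N) → ℝ)
    (hGbdd : ∃ C : ℝ, ∀ ξ β u v, |G ξ β u v| ≤ C)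
    (hGper : ∀ ξ β γ u v, G ξ (β + γ) u v = G ξ β u v)
    (Ghom : EuclideanSpace ℝ (Fin N) → ℝ)
    (hGhom : ∀ z ∈ Metric.closedBall (0 : EuclideanSpace ℝ (Fin N)) 1,
      Filter.Tendsto (fun T => gT m N R G T z) Filter.atTop (nhds (Ghom z))) :
    ConvexOn ℝ (Metric.closedBall 0 1) Ghom := by
  obtain ⟨C, hC⟩ := hGbdd
  have hlim := fun z hz => tendsto_sInf_admissibleEnergies_div (hGhom z hz)
  refine convexOn_of_rat_of_bddAbove (M := (rangeSet m R).card * C) (convex_closedBall 0 1)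
    (fun z hz => ?_) (fun z₁ hz₁ z₂ hz₂ q hq0 hq1 => ?_)
  · refine le_of_tendsto (hlim z hz) ?_
    filter_upwards [Filter.eventually_gt_atTop 0] with n hn
    rw [div_le_iff₀ (by positivity)]
    exact (abs_le.1 (abs_sInf_admissibleEnergies_le hC n z)).2
  · have hq0' : (0 : ℝ) ≤ q := by exact_mod_cast hq0
    have hq1' : (q : ℝ) ≤ 1 := by exact_mod_cast hq1
    have hz := convex_closedBall (0 : EuclideanSpace ℝ (Fin N)) 1 hz₁ hz₂ hq0'
      (sub_nonneg.2 hq1') (add_sub_cancel _ _)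
    obtain ⟨k, rfl⟩ : ∃ k, m = k + 1 := ⟨m - 1, by omega⟩
    set b : ℕ := q.den with hbdef
    have hb : 0 < b := q.den_pos
    have hb' : (0 : ℝ) < b := by exact_mod_cast hb
    have hqb : (q : ℝ) * b = q.num.toNat := by
      have h1 : q * b = q.num := Rat.mul_den_eq_num q
      have h2 : (q.num.toNat : ℤ) = q.num := Int.toNat_of_nonneg (Rat.num_nonneg.2 hq0)
      have h3 : (q.num.toNat : ℚ) = q.num := by exact_mod_cast h2
      rw [← h3] at h1
      exact_mod_cast h1
    have ht : (q : ℝ) * (b : ℝ) ^ (k + 1) = (q.num.toNat * b ^ k : ℕ) := by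
      push_cast
      rw [← hqb]
      ring
    have hh : q.num.toNat * b ^ k ≤ b ^ (k + 1) := by
      have : ((q.num.toNat * b ^ k : ℕ) : ℝ) ≤ (b ^ (k + 1) : ℕ) := by
        rw [← ht]
        push_cast
        exact mul_le_of_le_one_left (by positivity) hq1'
      exact_mod_cast this
    have herr : Filter.Tendsto (fun n : ℕ => (rangeSet (k + 1) R).card * C *
        (1 - (1 - 2 * (⌈R⌉₊ : ℝ) * (1 / (n : ℝ))) ^ (k + 1))) Filter.atTop (nhds 0) := by
      simpa using (((((tendsto_one_div_atTop_nhds_zero_nat (𝕜 := ℝ)).const_mul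
        (2 * (⌈R⌉₊ : ℝ))).const_sub 1).pow (k + 1)).const_sub 1).const_mul
        ((rangeSet (k + 1) R).card * C)
    have hleft := (hlim _ hz).comp
      (Filter.tendsto_atTop_mono (fun n => Nat.le_mul_of_pos_left n hb) Filter.tendsto_id)
    have hright := (((hlim z₁ hz₁).const_mul (q : ℝ)).add
      ((hlim z₂ hz₂).const_mul (1 - (q : ℝ)))).add herr
    rw [add_zero] at hright
    refine le_of_tendsto_of_tendsto hleft hright ?_
    filter_upwards [Filter.eventually_ge_atTop 2, Filter.eventually_ge_atTop (2 * ⌈R⌉₊)]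
      with n hn hnR
    have hn' : (0 : ℝ) < n := by exact_mod_cast (by omega : 0 < n)
    have hle := sInf_admissibleEnergies_mul_le hm hN hC hGper hb hn hnR hh ht hq0' hq1'
      (mem_closedBall_zero_iff.1 hz₁) (mem_closedBall_zero_iff.1 hz₂)
    have hpow : ((n : ℝ) - 2 * ⌈R⌉₊) ^ (k + 1) =
        (1 - 2 * (⌈R⌉₊ : ℝ) * (1 / (n : ℝ))) ^ (k + 1) * (n : ℝ) ^ (k + 1) := by
      rw [← mul_pow]
      congr 1
      field_simp
    simp only [Function.comp_apply]
    rw [div_le_iff₀ (by positivity)]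
    refine hle.trans_eq ?_
    rw [hpow]
    push_cast
    rw [mul_pow]
    have : (n : ℝ) ^ (k + 1) ≠ 0 := by positivity
    field_simp
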